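/- Let W be an n×n real doubly stochastic matrix and μ ∈ ℝ. Consider the gossip-with-GUT average-consensus recursion on d×n real matrices: X^{t+1} = X^t + Y^t for t ≥ 0, with Y^0 = X^0 (W − I) and, for t ≥ 1, Y^t = X^t (W − I) + μ [ Y^{t−1} W − (X^{t−1} − X^t)(W − I) ]. Then for every t ≥ 0 one has Y^t · (1/n) 𝟙𝟙ᵀ = 0, and hence the column-average is preserved: X^t · (1/n) 𝟙𝟙ᵀ = X^0 · (1/n) 𝟙𝟙ᵀ for all t ≥ 0. -/

import Mathlib

/-- The averaging matrix `(1/n) 𝟙𝟙ᵀ`, all of whose entries equal `1/n`. -/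
noncomputable def avgMat (n : ℕ) : Matrix (Fin n) (Fin n) ℝ := Matrix.of fun _ _ => (n : ℝ)⁻¹

/-- A matrix whose rows sum to `1` fixes the averaging matrix under left multiplication. -/
theorem mul_avgMat_of_row_sum_eq_one {n : ℕ} {W : Matrix (Fin n) (Fin n) ℝ}
    (hW : ∀ i, ∑ j, W i j = 1) : W * avgMat n = avgMat n := by
  ext i j
  simp [Matrix.mul_apply, avgMat, ← Finset.sum_mul, hW]

/-- **Average preservation for gossip with GUT (average consensus task).** For a doubly
stochastic `W`, the recursion `X^{t+1} = X^t + Y^t` with `Y^0 = X^0 (W − I)` and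
`Y^t = X^t (W − I) + μ [Y^{t−1} W − (X^{t−1} − X^t)(W − I)]` for `t ≥ 1` satisfies
`Y^t · (1/n)𝟙𝟙ᵀ = 0` for all `t`, and hence the column average is preserved:
`X^t · (1/n)𝟙𝟙ᵀ = X^0 · (1/n)𝟙𝟙ᵀ` for all `t`. -/
theorem gut_consensus_preserves_average
    {d n : ℕ} (W : Matrix (Fin n) (Fin n) ℝ)
    (hWnonneg : ∀ i j, 0 ≤ W i j)
    (hWrow : ∀ i, ∑ j, W i j = 1)
    (hWcol : ∀ j, ∑ i, W i j = 1)
    (μ : ℝ)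
    (X Y : ℕ → Matrix (Fin d) (Fin n) ℝ)
    (hX : ∀ t : ℕ, X (t + 1) = X t + Y t)
    (hY0 : Y 0 = X 0 * (W - 1))
    (hY : ∀ t : ℕ,
      Y (t + 1) = X (t + 1) * (W - 1) + μ • (Y t * W - (X t - X (t + 1)) * (W - 1))) :
    (∀ t : ℕ, Y t * avgMat n = 0) ∧
      (∀ t : ℕ, X t * avgMat n = X 0 * avgMat n) := by
  have havg : (W - 1) * avgMat n = 0 := by
    rw [sub_mul, mul_avgMat_of_row_sum_eq_one hWrow, one_mul, sub_self]
  have hYavg : ∀ t, Y t * avgMat n = 0 := by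
    intro t
    induction t with
    | zero => rw [hY0, Matrix.mul_assoc, havg, Matrix.mul_zero]
    | succ t ih =>
      rw [hY, Matrix.add_mul, Matrix.smul_mul, Matrix.sub_mul, Matrix.mul_assoc, havg,
        Matrix.mul_assoc (Y t), mul_avgMat_of_row_sum_eq_one hWrow, ih, Matrix.mul_assoc, havg]
      simp
  refine ⟨hYavg, fun t => ?_⟩
  induction t with
  | zero => rfl
  | succ t ih => rw [hX, Matrix.add_mul, hYavg, add_zero, ih]
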